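/- Let (h, e, f) be an sl(2)-triple in g, i.e. [h, e] = 2e, [h, f] = −2f and [e, f] = h, and let P, Q : g → g be ad-equivariant. Set y_P = dP(e).h, y_Q = dQ(e).h, z_P = P(e), z_Q = Q(e). Then [y_P, z_Q] = [y_Q, z_P]. -/

import Mathlib

/-- Differentiating the identity `lie (P x) (Q x) = 0` for commuting maps `P` and `Q`. -/
theorem lie_fderiv_add_lie_fderiv_eq_zero {g : Type*} [NormedAddCommGroup g] [NormedSpace ℂ g]
    [FiniteDimensional ℂ g] (lie : g →ₗ[ℂ] g →ₗ[ℂ] g) {P Q : g → g}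
    (hP : Differentiable ℂ P) (hQ : Differentiable ℂ Q)
    (hPQ : ∀ x, lie (P x) (Q x) = 0) (x v : g) :
    lie (P x) (fderiv ℂ Q x v) + lie (fderiv ℂ P x v) (Q x) = 0 := by
  have hd := lie.toContinuousBilinearMap.hasFDerivAt_of_bilinear
    (hP x).hasFDerivAt (hQ x).hasFDerivAt
  have hzero : (fun y => lie.toContinuousBilinearMap (P y) (Q y)) = fun _ => (0 : g) :=
    funext hPQ
  rw [hzero] at hd
  simpa using congrArg (fun L : g →L[ℂ] g => L v) (hd.unique (hasFDerivAt_const 0 x))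

theorem stmt {g : Type*} [NormedAddCommGroup g] [NormedSpace ℂ g] [FiniteDimensional ℂ g]
    -- `lie` is the Lie bracket of the finite-dimensional complex Lie algebra `g`,
    -- given as bilinear data so that it is compatible with the normed space structure.
    (lie : g →ₗ[ℂ] g →ₗ[ℂ] g)
    (lie_self : ∀ x : g, lie x x = 0)
    (lie_jacobi : ∀ x y z : g, lie x (lie y z) = lie (lie x y) z + lie y (lie x z))
    (h e f : g)
    (hhe : lie h e = (2 : ℂ) • e)
    (hhf : lie h f = (-2 : ℂ) • f)
    (hef : lie e f = h)
    (P Q : g → g) (hP : ContDiff ℂ ⊤ P) (hQ : ContDiff ℂ ⊤ Q)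
    (hPeq : ∀ x y : g, fderiv ℂ P x (lie y x) = lie y (P x))
    (hQeq : ∀ x y : g, fderiv ℂ Q x (lie y x) = lie y (Q x)) :
    lie (fderiv ℂ P e h) (Q e) = lie (fderiv ℂ Q e h) (P e) := by
  have skew (x y : g) : lie x y = -lie y x := (LinearMap.IsAlt.neg lie_self y x).symm
  have commute_self (x : g) : lie (P x) x = 0 := by
    rw [skew, ← hPeq x x, lie_self, map_zero, neg_zero]
  have commute (x : g) : lie (P x) (Q x) = 0 := by
    rw [← hQeq x (P x), commute_self, map_zero]
  have hsum := lie_fderiv_add_lie_fderiv_eq_zero lie (hP.differentiable (by simp))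
    (hQ.differentiable (by simp)) commute e h
  rw [skew (P e)] at hsum
  exact (neg_add_eq_zero.mp hsum).symm
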